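/- Let G be a countable discrete amenable group, (V,‖·‖) a complete semi-normed real vector space, and π: G → Isom(V) a uniformly bounded representation. Then: (i) M_⊕ is |||·|||_G-complete; (ii) the set A of asymptotically additive maps (the |||·|||_G-closure of M_⊕ in M) is |||·|||_G-complete and |||·|||_G-closed; (iii) A = M_⊕ + N, and the images of M_⊕ and A in the quotient M/N coincide. -/

import Mathlib

open scoped Pointwise
open Filter

/-- The collection `F(G)` of non-empty finite subsets of `G`. -/
def FinG (G : Type*) := {F : Finset G // F.Nonempty}

section Defs

variable {G : Type*} [Group G] [DecidableEq G]

/-- `F` is `(K, δ)`-invariant: `|KF Δ F| ≤ δ|F|`. -/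
def IsInv (K : Finset G) (δ : ℝ) (F : Finset G) : Prop :=
  ((symmDiff (K * F) F).card : ℝ) ≤ δ * (F.card : ℝ)

/-- `G` is amenable: for every `(K, δ)` there is a `(K, δ)`-invariant nonempty finite set. -/
def AmenableG (G : Type*) [Group G] [DecidableEq G] : Prop :=
  ∀ K : Finset G, K.Nonempty → ∀ δ : ℝ, 0 < δ →
    ∃ F : Finset G, F.Nonempty ∧ IsInv K δ F

/-- `limsup_{F → G} φ(F) = inf_{(K,δ)} sup {φ(F) : F is (K,δ)-invariant}` (in the extended reals). -/
noncomputable def limsupG (φ : FinG G → ℝ) : EReal :=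
  ⨅ (K : {K : Finset G // K.Nonempty}) (δ : {d : ℝ // 0 < d}),
    ⨆ F : {F : FinG G // IsInv K.1 δ.1 F.1}, (φ F.1 : EReal)

/-- `liminf_{F → G} φ(F) = sup_{(K,δ)} inf {φ(F) : F is (K,δ)-invariant}` (in the extended reals). -/
noncomputable def liminfG (φ : FinG G → ℝ) : EReal :=
  ⨆ (K : {K : Finset G // K.Nonempty}) (δ : {d : ℝ // 0 < d}),
    ⨅ F : {F : FinG G // IsInv K.1 δ.1 F.1}, (φ F.1 : EReal)

/-- `lim_{F → G} φ(F) = L`. -/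
def TendstoG (φ : FinG G → ℝ) (L : ℝ) : Prop :=
  ∀ ε : ℝ, 0 < ε → ∃ (K : Finset G) (δ : ℝ), K.Nonempty ∧ 0 < δ ∧
    ∀ F : FinG G, IsInv K δ F.1 → |φ F - L| < ε

/-- A (left) Følner sequence: `|F_n Δ g F_n| / |F_n| → 0` for every `g ∈ G`. -/
def FolnerSeq (F : ℕ → FinG G) : Prop :=
  ∀ g : G, Filter.Tendsto
    (fun n => ((symmDiff ((F n).1.image (fun h => g * h)) (F n).1).card : ℝ) / ((F n).1.card : ℝ))
    Filter.atTop (nhds (0 : ℝ))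

variable {V : Type*} [SeminormedAddCommGroup V] [NormedSpace ℝ V]

/-- The representation `π` is uniformly bounded with constant `C`. -/
def UnifBdd (π : G →* (V ≃L[ℝ] V)) (C : ℝ) : Prop :=
  ∀ (g : G) (v : V), ‖π g v‖ ≤ C * ‖v‖

/-- The representation `π` is isometric (`C_π = 1`). -/
def IsIsometric (π : G →* (V ≃L[ℝ] V)) : Prop :=
  ∀ (g : G) (v : V), ‖π g v‖ = ‖v‖

/-- The ergodic sum `S_F v = Σ_{g ∈ F} π(g⁻¹) v`. -/
noncomputable def SF (π : G →* (V ≃L[ℝ] V)) (F : Finset G) (v : V) : V :=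
  ∑ g ∈ F, π g⁻¹ v

/-- The ergodic average `A_F v = |F|⁻¹ • S_F v`. -/
noncomputable def AF (π : G →* (V ≃L[ℝ] V)) (F : Finset G) (v : V) : V :=
  (F.card : ℝ)⁻¹ • SF π F v

/-- Right translation `g • F = F g⁻¹` on nonempty finite subsets. -/
def rT (g : G) (F : FinG G) : FinG G :=
  ⟨F.1.image (fun h => h * g⁻¹), F.2.image (fun h => h * g⁻¹)⟩

/-- `G`-equivariance of a set map: `π(g) φ(F) = φ(F g⁻¹)`. -/
def IsEquivariant (π : G →* (V ≃L[ℝ] V)) (φ : FinG G → V) : Prop :=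
  ∀ (g : G) (F : FinG G), π g (φ F) = φ (rT g F)

/-- Boundedness of a set map: `sup_F ‖φ(F)‖/|F| < ∞`. -/
def IsBddMap (φ : FinG G → V) : Prop :=
  ∃ C : ℝ, ∀ F : FinG G, ‖φ F‖ ≤ C * (F.1.card : ℝ)

/-- Membership in the space `M` of bounded `G`-equivariant set maps. -/
def MemM (π : G →* (V ≃L[ℝ] V)) (φ : FinG G → V) : Prop :=
  IsBddMap φ ∧ IsEquivariant π φ

/-- The sup seminorm `|||φ|||_sup = sup_F ‖φ(F)‖/|F|`. -/
noncomputable def supNorm (φ : FinG G → V) : ℝ :=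
  ⨆ F : FinG G, ‖φ F‖ / (F.1.card : ℝ)

/-- The asymptotic seminorm `|||φ|||_G = limsup_{F → G} ‖φ(F)‖/|F|` (in the extended reals). -/
noncomputable def normG (φ : FinG G → V) : EReal :=
  limsupG (fun F => ‖φ F‖ / (F.1.card : ℝ))

/-- Union of nonempty finite subsets. -/
def unionF (E F : FinG G) : FinG G :=
  ⟨E.1 ∪ F.1, E.2.inl⟩

/-- Additive set maps: `φ(E ⊔ F) = φ(E) + φ(F)` for disjoint `E, F`. -/
def IsAdditiveMap (φ : FinG G → V) : Prop :=
  ∀ E F : FinG G, Disjoint E.1 F.1 → φ (unionF E F) = φ E + φ F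

/-- The additive set map `S(v)(F) = S_F v`. -/
noncomputable def Smap (π : G →* (V ≃L[ℝ] V)) (v : V) : FinG G → V :=
  fun F => SF π F.1 v

/-- The coboundary subspace `L_W = span{w − π(g)w : w ∈ W, g ∈ G}`. -/
def cobSpan (π : G →* (V ≃L[ℝ] V)) (W : Set V) : Submodule ℝ V :=
  Submodule.span ℝ {x | ∃ w ∈ W, ∃ g : G, x = w - π g w}

/-- The coboundary subspace `L = L_V`. -/
def cobL (π : G →* (V ≃L[ℝ] V)) : Submodule ℝ V :=
  cobSpan π Set.univ

/-- The quotient seminorm `‖v + U‖_U = inf_{u ∈ U} ‖v + u‖`. -/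
noncomputable def qnorm (U : Set V) (v : V) : ℝ :=
  ⨅ u : U, ‖v + u.1‖

/-- `v` is an additive realization of `φ`: `lim_{F→G} ‖φ(F)/|F| − A_F v‖ = 0`. -/
def IsRealization (π : G →* (V ≃L[ℝ] V)) (φ : FinG G → V) (v : V) : Prop :=
  TendstoG (fun F => ‖(F.1.card : ℝ)⁻¹ • φ F - AF π F.1 v‖) 0

/-- `φ` is asymptotically additive: `inf_{ψ ∈ M_⊕} |||φ − ψ|||_G = 0`. -/
def AsympAdd (π : G →* (V ≃L[ℝ] V)) (φ : FinG G → V) : Prop :=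
  (⨅ ψ : {ψ : FinG G → V // MemM π ψ ∧ IsAdditiveMap ψ}, normG (φ - ψ.1)) = (0 : EReal)

/-- `φ` is asymptotically additive relative to `W`. -/
def AsympAddRel (π : G →* (V ≃L[ℝ] V)) (W : Set V) (φ : FinG G → V) : Prop :=
  (⨅ w : W, limsupG (fun F => ‖(F.1.card : ℝ)⁻¹ • φ F - AF π F.1 w.1‖)) = (0 : EReal)

/-- The quotient norm on `M_⊕ / N_⊕`. -/
noncomputable def qMplusN (π : G →* (V ≃L[ℝ] V)) (ψ : FinG G → V) : ℝ :=
  ⨅ η : {η : FinG G → V // MemM π η ∧ IsAdditiveMap η ∧ normG η = (0 : EReal)},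
    supNorm (ψ + η.1)

end Defs

section AsymptoticBounds

lemma FinG.card_pos {G : Type*} (F : FinG G) : (0 : ℝ) < F.1.card := by
  exact_mod_cast Finset.card_pos.2 F.2

variable {G : Type*} [Group G] [DecidableEq G]

lemma IsInv.mono {K L F : Finset G} {δ ε : ℝ} (hF : IsInv L δ F) (hK : K.Nonempty) (hKL : K ⊆ L)
    (h : 2 * δ ≤ ε) : IsInv K ε F := by
  have hle : F.card ≤ (K * F).card := Finset.card_le_card_mul_left hK
  have h1 : (F \ (K * F)).card ≤ ((K * F) \ F).card := by
    have e1 := Finset.card_sdiff_add_card_inter F (K * F)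
    have e2 := Finset.card_sdiff_add_card_inter (K * F) F
    rw [Finset.inter_comm] at e2
    omega
  have h2 : ((K * F) \ F).card ≤ (symmDiff (L * F) F).card := by
    apply Finset.card_le_card
    intro x hx
    rw [Finset.mem_sdiff] at hx
    exact Finset.mem_symmDiff.2 (.inl ⟨Finset.mul_subset_mul_right hKL hx.1, hx.2⟩)
  have h3 : (symmDiff (K * F) F).card ≤ ((K * F) \ F).card + (F \ (K * F)).card :=
    Finset.card_union_le _ _
  have h4 : ((symmDiff (K * F) F).card : ℝ) ≤ 2 * (symmDiff (L * F) F).card := by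
    exact_mod_cast (by omega :
      (symmDiff (K * F) F).card ≤ 2 * (symmDiff (L * F) F).card)
  unfold IsInv at hF ⊢
  have : 2 * δ * (F.card : ℝ) ≤ ε * F.card := by gcongr
  linarith

lemma limsupG_nonneg (hG : AmenableG G) {f : FinG G → ℝ} (hf : ∀ F, 0 ≤ f F) :
    0 ≤ limsupG f := by
  refine le_iInf fun K => le_iInf fun δ => ?_
  obtain ⟨F, hF, hinv⟩ := hG K.1 K.2 δ.1 δ.2
  exact le_iSup_of_le (⟨⟨F, hF⟩, hinv⟩ : {F : FinG G // IsInv K.1 δ.1 F.1})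
    (EReal.coe_nonneg.2 (hf _))

variable {V : Type*} [SeminormedAddCommGroup V]

/-- `‖φ(F)‖ ≤ ε|F|` for all sufficiently invariant `F`. -/
def AsympLE (φ : FinG G → V) (ε : ℝ) : Prop :=
  ∃ (K : Finset G) (δ : ℝ), K.Nonempty ∧ 0 < δ ∧
    ∀ F : FinG G, IsInv K δ F.1 → ‖φ F‖ ≤ ε * (F.1.card : ℝ)

lemma AsympLE.of_forall {φ : FinG G → V} {ε : ℝ} (h : ∀ F : FinG G, ‖φ F‖ ≤ ε * (F.1.card : ℝ)) :
    AsympLE φ ε :=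
  ⟨{1}, 1, Finset.singleton_nonempty 1, one_pos, fun F _ => h F⟩

lemma AsympLE.mono {φ : FinG G → V} {a b : ℝ} (h : AsympLE φ a) (hab : a ≤ b) : AsympLE φ b := by
  obtain ⟨K, δ, hK, hδ, h⟩ := h
  exact ⟨K, δ, hK, hδ, fun F hF => (h F hF).trans (by gcongr)⟩

lemma AsympLE.add {φ ψ : FinG G → V} {a b : ℝ} (hφ : AsympLE φ a) (hψ : AsympLE ψ b) :
    AsympLE (φ + ψ) (a + b) := by
  obtain ⟨K, δ, hK, hδ, hφ⟩ := hφ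
  obtain ⟨L, η, hL, hη, hψ⟩ := hψ
  refine ⟨K ∪ L, min δ η / 2, hK.inl, half_pos (lt_min hδ hη), fun F hF => ?_⟩
  have h1 := hφ F (hF.mono hK Finset.subset_union_left (by linarith [min_le_left δ η]))
  have h2 := hψ F (hF.mono hL Finset.subset_union_right (by linarith [min_le_right δ η]))
  rw [add_mul]
  exact (norm_add_le _ _).trans (add_le_add h1 h2)

lemma AsympLE.sub_comm {φ ψ : FinG G → V} {a : ℝ} (h : AsympLE (φ - ψ) a) :
    AsympLE (ψ - φ) a := by
  obtain ⟨K, δ, hK, hδ, h⟩ := h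
  exact ⟨K, δ, hK, hδ, fun F hF => by simpa [norm_sub_rev] using h F hF⟩

lemma AsympLE.sub_trans {φ ψ χ : FinG G → V} {a b : ℝ} (h₁ : AsympLE (φ - ψ) a)
    (h₂ : AsympLE (ψ - χ) b) : AsympLE (φ - χ) (a + b) := by
  simpa using h₁.add h₂

lemma normG_nonneg (hG : AmenableG G) (φ : FinG G → V) : 0 ≤ normG φ :=
  limsupG_nonneg hG fun _ => by positivity

lemma AsympLE.normG_le {φ : FinG G → V} {ε : ℝ} (h : AsympLE φ ε) : normG φ ≤ (ε : EReal) := by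
  obtain ⟨K, δ, hK, hδ, h⟩ := h
  refine iInf_le_of_le ⟨K, hK⟩ (iInf_le_of_le ⟨δ, hδ⟩ (iSup_le fun F => ?_))
  exact EReal.coe_le_coe_iff.2 ((div_le_iff₀ F.1.card_pos).2 (h F.1 F.2))

lemma AsympLE.of_normG_lt {φ : FinG G → V} {ε : ℝ} (h : normG φ < (ε : EReal)) :
    AsympLE φ ε := by
  obtain ⟨K, h⟩ := iInf_lt_iff.1 h
  obtain ⟨δ, h⟩ := iInf_lt_iff.1 h
  refine ⟨K.1, δ.1, K.2, δ.2, fun F hF => (div_le_iff₀ F.card_pos).1 ?_⟩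
  exact EReal.coe_le_coe_iff.1 ((le_iSup (fun F : {F : FinG G // IsInv K.1 δ.1 F.1} =>
    ((‖φ F.1‖ / (F.1.1.card : ℝ) : ℝ) : EReal)) ⟨F, hF⟩).trans h.le)

lemma normG_eq_zero_iff (hG : AmenableG G) {φ : FinG G → V} :
    normG φ = 0 ↔ ∀ ε : ℝ, 0 < ε → AsympLE φ ε := by
  refine ⟨fun h ε hε => .of_normG_lt (by rw [h]; exact_mod_cast hε), fun h => ?_⟩
  refine le_antisymm (EReal.le_of_forall_lt_iff_le.1 fun ε hε => ?_) (normG_nonneg hG φ)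
  exact (h ε (by exact_mod_cast hε)).normG_le

lemma tendsto_normG_zero_iff (hG : AmenableG G) {φ : ℕ → FinG G → V} :
    Tendsto (fun n => normG (φ n)) atTop (nhds (0 : EReal)) ↔
      ∀ ε : ℝ, 0 < ε → ∃ N, ∀ n ≥ N, AsympLE (φ n) ε := by
  constructor
  · intro h ε hε
    obtain ⟨N, hN⟩ := eventually_atTop.1 (h.eventually_lt_const
      (show (0 : EReal) < (ε : EReal) by exact_mod_cast hε))
    exact ⟨N, fun n hn => .of_normG_lt (hN n hn)⟩
  · intro h
    refine tendsto_order.2 ⟨fun a ha => .of_forall fun n => ha.trans_le (normG_nonneg hG _),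
      fun a ha => ?_⟩
    obtain ⟨ε, hε, hεa⟩ := EReal.lt_iff_exists_real_btwn.1 ha
    obtain ⟨N, hN⟩ := h ε (by exact_mod_cast hε)
    exact eventually_atTop.2 ⟨N, fun n hn => (hN n hn).normG_le.trans_lt hεa⟩

variable [NormedSpace ℝ V]

lemma AsympLE.const_smul {φ : FinG G → V} {a : ℝ} (h : AsympLE φ a) (c : ℝ) :
    AsympLE (c • φ) (|c| * a) := by
  obtain ⟨K, δ, hK, hδ, h⟩ := h
  refine ⟨K, δ, hK, hδ, fun F hF => ?_⟩
  rw [Pi.smul_apply, norm_smul, Real.norm_eq_abs, mul_assoc]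
  exact mul_le_mul_of_nonneg_left (h F hF) (abs_nonneg c)

lemma asympAdd_iff (hG : AmenableG G) {π : G →* (V ≃L[ℝ] V)} {φ : FinG G → V} :
    AsympAdd π φ ↔
      ∀ ε : ℝ, 0 < ε → ∃ ψ, MemM π ψ ∧ IsAdditiveMap ψ ∧ AsympLE (φ - ψ) ε := by
  constructor
  · intro h ε hε
    have hlt : (⨅ ψ : {ψ : FinG G → V // MemM π ψ ∧ IsAdditiveMap ψ}, normG (φ - ψ.1))
        < (ε : EReal) := by
      rw [show _ = _ from h]; exact_mod_cast hε
    obtain ⟨ψ, hψ⟩ := iInf_lt_iff.1 hlt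
    exact ⟨ψ.1, ψ.2.1, ψ.2.2, .of_normG_lt hψ⟩
  · intro h
    refine le_antisymm (EReal.le_of_forall_lt_iff_le.1 fun ε hε => ?_)
      (le_iInf fun ψ => normG_nonneg hG _)
    obtain ⟨ψ, h1, h2, h3⟩ := h ε (by exact_mod_cast hε)
    exact iInf_le_of_le ⟨ψ, h1, h2⟩ h3.normG_le

lemma MemM.sub {π : G →* (V ≃L[ℝ] V)} {φ ψ : FinG G → V} (hφ : MemM π φ) (hψ : MemM π ψ) :
    MemM π (φ - ψ) := by
  obtain ⟨⟨a, ha⟩, hφ⟩ := hφ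
  obtain ⟨⟨b, hb⟩, hψ⟩ := hψ
  refine ⟨⟨a + b, fun F => ?_⟩, fun g F => ?_⟩
  · rw [add_mul]
    exact (norm_sub_le _ _).trans (add_le_add (ha F) (hb F))
  · simp [hφ g F, hψ g F]

end AsymptoticBounds

section ErgodicSums

variable {G : Type*} [Group G]
  {V : Type*} [SeminormedAddCommGroup V] [NormedSpace ℝ V] (π : G →* (V ≃L[ℝ] V))

lemma Smap_add (v w : V) : Smap π (v + w) = Smap π v + Smap π w := by
  ext F; simp [Smap, SF, Finset.sum_add_distrib]

lemma Smap_sub (v w : V) : Smap π (v - w) = Smap π v - Smap π w := by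
  ext F; simp [Smap, SF, Finset.sum_sub_distrib]

lemma Smap_smul (c : ℝ) (v : V) : Smap π (c • v) = c • Smap π v := by
  ext F; simp [Smap, SF, Finset.smul_sum]

variable {π}

lemma UnifBdd.abs {C : ℝ} (hπ : UnifBdd π C) : UnifBdd π |C| := fun g v =>
  (hπ g v).trans (by gcongr; exact le_abs_self C)

lemma UnifBdd.norm_SF_le {C : ℝ} (hπ : UnifBdd π C) (F : Finset G) (v : V) :
    ‖SF π F v‖ ≤ C * ‖v‖ * (F.card : ℝ) := by
  refine (norm_sum_le_of_le F fun g _ => hπ g⁻¹ v).trans_eq ?_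
  rw [Finset.sum_const, nsmul_eq_mul, mul_comm]

variable [DecidableEq G]

lemma isAdditiveMap_Smap (π : G →* (V ≃L[ℝ] V)) (v : V) : IsAdditiveMap (Smap π v) := fun _ _ h =>
  Finset.sum_union h

lemma UnifBdd.memM_Smap {C : ℝ} (hπ : UnifBdd π C) (v : V) : MemM π (Smap π v) := by
  refine ⟨⟨C * ‖v‖, fun F => hπ.norm_SF_le F.1 v⟩, fun g F => ?_⟩
  simp only [Smap, SF, rT, map_sum]
  rw [Finset.sum_image fun x _ y _ h => mul_right_cancel h]
  refine Finset.sum_congr rfl fun h _ => ?_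
  rw [mul_inv_rev, inv_inv, map_mul]
  rfl

/-- The singleton `{g}` as an element of `F(G)`. -/
def FinG.single {G : Type*} (g : G) : FinG G := ⟨{g}, Finset.singleton_nonempty g⟩

/-- An equivariant additive map is determined by its value at `{1}`. -/
lemma IsAdditiveMap.eq_Smap {ψ : FinG G → V} (hadd : IsAdditiveMap ψ) (heq : IsEquivariant π ψ) :
    ψ = Smap π (ψ (FinG.single 1)) := by
  have hs (h : G) : ψ (FinG.single h) = π h⁻¹ (ψ (FinG.single 1)) := by
    rw [heq]
    congr 1
    apply Subtype.ext
    simp [rT, FinG.single]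
  funext ⟨F, hF⟩
  induction hF using Finset.Nonempty.cons_induction with
  | singleton a =>
    refine (hs a).trans ?_
    simp only [Smap, SF, Finset.sum_singleton]
  | cons a s ha hs' ih =>
    have hu : unionF (FinG.single a) ⟨s, hs'⟩ =
        (⟨Finset.cons a s ha, Finset.cons_nonempty ha⟩ : FinG G) :=
      Subtype.ext (Finset.cons_eq_insert a s ha).symm
    have h := hadd (FinG.single a) ⟨s, hs'⟩ (Finset.disjoint_singleton_left.2 ha)
    rw [hu, ih, hs] at h
    refine h.trans ?_
    simp only [Smap, SF, Finset.sum_cons]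

lemma UnifBdd.norm_SF_sub_SF_le {C : ℝ} (hπ : UnifBdd π C) (E F : Finset G) (v : V) :
    ‖SF π E v - SF π F v‖ ≤ C * ‖v‖ * ((symmDiff E F).card : ℝ) := by
  have h : SF π E v - SF π F v = SF π (E \ F) v - SF π (F \ E) v :=
    (Finset.sum_sdiff_sub_sum_sdiff (s₁ := F) (s₂ := E) (f := fun g => π g⁻¹ v)).symm
  have hc : ((symmDiff E F).card : ℝ) = (E \ F).card + (F \ E).card := by
    rw [symmDiff_def, Finset.sup_eq_union, Finset.card_union_of_disjoint disjoint_sdiff_sdiff]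
    push_cast; rfl
  rw [h, hc, mul_add]
  exact (norm_sub_le _ _).trans (add_le_add (hπ.norm_SF_le _ v) (hπ.norm_SF_le _ v))

lemma SF_map_inv (g : G) (F : Finset G) (v : V) : SF π F (π g⁻¹ v) = SF π ({g} * F) v := by
  rw [SF, SF, Finset.singleton_mul, ← Finset.image_smul]
  simp only [smul_eq_mul]
  rw [Finset.sum_image fun x _ y _ h => mul_left_cancel h]
  refine Finset.sum_congr rfl fun h _ => ?_
  rw [mul_inv_rev, map_mul]
  rfl

variable (π) in
/-- The vectors whose ergodic sums vanish asymptotically. -/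
def asympNull : Submodule ℝ V where
  carrier := {v | ∀ ε : ℝ, 0 < ε → AsympLE (Smap π v) ε}
  zero_mem' ε hε := .of_forall fun F => by
    simp only [Smap, SF, map_zero, Finset.sum_const_zero, norm_zero]
    positivity
  add_mem' {v w} hv hw ε hε := by
    rw [Smap_add]
    simpa using (hv _ (half_pos hε)).add (hw _ (half_pos hε))
  smul_mem' c v hv ε hε := by
    rw [Smap_smul]
    refine ((hv (ε / (|c| + 1)) (by positivity)).const_smul c).mono ?_
    rw [mul_div_assoc', div_le_iff₀ (by positivity)]
    nlinarith

lemma UnifBdd.map_inv_sub_mem_asympNull {C : ℝ} (hπ : UnifBdd π C) (g : G) (v : V) :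
    π g⁻¹ v - v ∈ asympNull π := by
  intro ε hε
  refine ⟨{g}, ε / (|C| * ‖v‖ + 1), Finset.singleton_nonempty g, by positivity, fun F hF => ?_⟩
  rw [Smap_sub, Pi.sub_apply, Smap, Smap, SF_map_inv]
  refine (hπ.abs.norm_SF_sub_SF_le _ _ v).trans ?_
  refine (mul_le_mul_of_nonneg_left hF (by positivity)).trans ?_
  rw [← mul_assoc]
  gcongr
  rw [mul_div_assoc', div_le_iff₀ (by positivity)]
  nlinarith

lemma UnifBdd.AF_sub_mem_asympNull {C : ℝ} (hπ : UnifBdd π C) (F : FinG G) (v : V) :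
    AF π F.1 v - v ∈ asympNull π := by
  have h : AF π F.1 v - v = (F.1.card : ℝ)⁻¹ • ∑ g ∈ F.1, (π g⁻¹ v - v) := by
    rw [Finset.sum_sub_distrib, smul_sub, Finset.sum_const, ← Nat.cast_smul_eq_nsmul ℝ,
      inv_smul_smul₀ F.card_pos.ne']
    rfl
  rw [h]
  exact Submodule.smul_mem _ _ (Submodule.sum_mem _ fun g _ =>
    hπ.map_inv_sub_mem_asympNull g v)

lemma AsympLE.exists_norm_sub_le {C ε : ℝ} {v : V} (h : AsympLE (Smap π v) ε)
    (hG : AmenableG G) (hπ : UnifBdd π C) : ∃ u ∈ asympNull π, ‖v - u‖ ≤ ε := by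
  obtain ⟨K, δ, hK, hδ, h⟩ := h
  obtain ⟨F, hF, hinv⟩ := hG K hK δ hδ
  refine ⟨v - AF π F v, ?_, ?_⟩
  · rw [← neg_sub]
    exact Submodule.neg_mem _ (hπ.AF_sub_mem_asympNull ⟨F, hF⟩ v)
  · rw [sub_sub_cancel, AF, norm_smul, norm_inv, Real.norm_natCast,
      inv_mul_le_iff₀ (FinG.card_pos ⟨F, hF⟩), mul_comm]
    exact h ⟨F, hF⟩ hinv

variable [CompleteSpace V]

lemma UnifBdd.exists_Smap_limit {C : ℝ} (hπ : UnifBdd π C) (hG : AmenableG G) (v : ℕ → V)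
    (hv : ∀ ε : ℝ, 0 < ε → ∃ N : ℕ, ∀ m ≥ N, ∀ n ≥ N, AsympLE (Smap π (v m - v n)) ε) :
    ∃ w : V, ∀ ε : ℝ, 0 < ε → ∃ N : ℕ, ∀ n ≥ N, AsympLE (Smap π (v n - w)) ε := by
  choose N hN using fun k : ℕ => hv ((1 / 2) ^ k) (by positivity)
  let n : ℕ → ℕ := fun k => ∑ i ∈ Finset.range (k + 1), N i
  have hn {i k : ℕ} (h : i ≤ k) : N i ≤ n k :=
    Finset.single_le_sum (f := N) (fun _ _ => Nat.zero_le _)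
      (Finset.mem_range.2 (Nat.lt_succ_of_le h))
  choose u hu hvu using fun k : ℕ =>
    (hN k (n k) (hn le_rfl) (n (k + 1)) (hn k.le_succ)).exists_norm_sub_le hG hπ
  let x : ℕ → V := fun k => v (n k) + ∑ j ∈ Finset.range k, u j
  have hx : CauchySeq x := by
    refine cauchySeq_of_le_geometric (1 / 2) 1 (by norm_num) fun k => ?_
    rw [dist_eq_norm, one_mul]
    convert hvu k using 2
    simp only [x, Finset.sum_range_succ]
    abel
  obtain ⟨w, hw⟩ := cauchySeq_tendsto_of_complete hx
  refine ⟨w, fun ε hε => ?_⟩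
  obtain ⟨M, hM⟩ := hv (ε / 3) (by positivity)
  have hC : (0 : ℝ) < ε / 3 / (|C| + 1) := by positivity
  obtain ⟨k₁, hk₁⟩ := Metric.tendsto_atTop.1 hw _ hC
  obtain ⟨k₂, hk₂⟩ := exists_pow_lt_of_lt_one (show 0 < ε / 3 by positivity)
    (show (1 / 2 : ℝ) < 1 by norm_num)
  let k := max k₁ k₂
  refine ⟨N k₂, fun m hm => ?_⟩
  have h1 : AsympLE (Smap π (v m - v (n k))) (ε / 3) :=
    (hN k₂ m hm (n k) (hn (le_max_right _ _))).mono hk₂.le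
  have h2 : AsympLE (Smap π (-∑ j ∈ Finset.range k, u j)) (ε / 3) :=
    (asympNull π).neg_mem (Submodule.sum_mem _ fun j _ => hu j) (ε / 3) (by positivity)
  have h3 : AsympLE (Smap π (x k - w)) (ε / 3) := by
    refine .of_forall fun F => (hπ.abs.norm_SF_le F.1 (x k - w)).trans ?_
    gcongr
    have h := hk₁ k (le_max_left _ _)
    rw [dist_eq_norm, lt_div_iff₀ (by positivity)] at h
    nlinarith [norm_nonneg (x k - w)]
  have h := (h1.add h2).add h3
  rw [← Smap_add, ← Smap_add, add_thirds] at h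
  convert h using 2
  simp only [x]
  abel

lemma UnifBdd.exists_additive_limit {C : ℝ} (hπ : UnifBdd π C) (hG : AmenableG G)
    (ψ : ℕ → FinG G → V) (hψ : ∀ n, MemM π (ψ n) ∧ IsAdditiveMap (ψ n))
    (hc : ∀ ε : ℝ, 0 < ε → ∃ N : ℕ, ∀ m ≥ N, ∀ n ≥ N, AsympLE (ψ m - ψ n) ε) :
    ∃ χ : FinG G → V, MemM π χ ∧ IsAdditiveMap χ ∧
      ∀ ε : ℝ, 0 < ε → ∃ N : ℕ, ∀ n ≥ N, AsympLE (ψ n - χ) ε := by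
  choose v hv using fun n => (⟨_, (hψ n).2.eq_Smap (hψ n).1.2⟩ : ∃ v, ψ n = Smap π v)
  simp only [hv, ← Smap_sub] at hc
  obtain ⟨w, hw⟩ := hπ.exists_Smap_limit hG v hc
  refine ⟨Smap π w, hπ.memM_Smap w, isAdditiveMap_Smap π w, ?_⟩
  simpa only [hv, ← Smap_sub] using hw

lemma AsympAdd.exists_additive {C : ℝ} {φ : FinG G → V} (hφ : AsympAdd π φ) (hπ : UnifBdd π C)
    (hG : AmenableG G) :
    ∃ ψ, MemM π ψ ∧ IsAdditiveMap ψ ∧ ∀ ε : ℝ, 0 < ε → AsympLE (φ - ψ) ε := by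
  choose ψ hM hadd hψ using fun k : ℕ =>
    (asympAdd_iff hG).1 hφ ((1 / 2) ^ k) (by positivity)
  have hsmall (ε : ℝ) (hε : 0 < ε) : ∃ N, ∀ n ≥ N, AsympLE (φ - ψ n) ε := by
    obtain ⟨N, hN⟩ := exists_pow_lt_of_lt_one hε (show (1 / 2 : ℝ) < 1 by norm_num)
    exact ⟨N, fun n hn => (hψ n).mono
      ((pow_le_pow_of_le_one (by norm_num) (by norm_num) hn).trans hN.le)⟩
  obtain ⟨χ, hχ, hχadd, hlim⟩ := hπ.exists_additive_limit hG ψ (fun n => ⟨hM n, hadd n⟩)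
    fun ε hε => by
      obtain ⟨N, hN⟩ := hsmall (ε / 2) (half_pos hε)
      exact ⟨N, fun m hm n hn => by
        simpa only [add_halves] using (hN m hm).sub_comm.sub_trans (hN n hn)⟩
  refine ⟨χ, hχ, hχadd, fun ε hε => ?_⟩
  obtain ⟨N, hN⟩ := hsmall (ε / 2) (half_pos hε)
  obtain ⟨N', hN'⟩ := hlim (ε / 2) (half_pos hε)
  simpa only [add_halves] using
    (hN _ (le_max_left N N')).sub_trans (hN' _ (le_max_right N N'))

end ErgodicSums

theorem statement14 {G : Type*} [Group G] [DecidableEq G] [Countable G]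
    {V : Type*} [SeminormedAddCommGroup V] [NormedSpace ℝ V] [CompleteSpace V]
    (hG : AmenableG G) (π : G →* (V ≃L[ℝ] V)) (C : ℝ) (hπ : UnifBdd π C) :
    -- (i) `M_⊕` is `|||·|||_G`-complete:
    (∀ ψ : ℕ → (FinG G → V), (∀ n, MemM π (ψ n) ∧ IsAdditiveMap (ψ n)) →
      (∀ ε : ℝ, 0 < ε → ∃ N : ℕ, ∀ m ≥ N, ∀ n ≥ N, normG (ψ m - ψ n) < (ε : EReal)) →
      ∃ χ : FinG G → V, MemM π χ ∧ IsAdditiveMap χ ∧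
        Filter.Tendsto (fun n => normG (ψ n - χ)) Filter.atTop (nhds (0 : EReal))) ∧
    -- (ii) the set `A` of asymptotically additive maps is `|||·|||_G`-complete …
    (∀ φ : ℕ → (FinG G → V), (∀ n, MemM π (φ n) ∧ AsympAdd π (φ n)) →
      (∀ ε : ℝ, 0 < ε → ∃ N : ℕ, ∀ m ≥ N, ∀ n ≥ N, normG (φ m - φ n) < (ε : EReal)) →
      ∃ χ : FinG G → V, MemM π χ ∧ AsympAdd π χ ∧
        Filter.Tendsto (fun n => normG (φ n - χ)) Filter.atTop (nhds (0 : EReal))) ∧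
    -- … and `|||·|||_G`-closed:
    (∀ φ : ℕ → (FinG G → V), (∀ n, MemM π (φ n) ∧ AsympAdd π (φ n)) →
      ∀ χ : FinG G → V, MemM π χ →
        Filter.Tendsto (fun n => normG (φ n - χ)) Filter.atTop (nhds (0 : EReal)) →
        AsympAdd π χ) ∧
    -- (iii) `A = M_⊕ + N` …
    (∀ φ : FinG G → V, MemM π φ →
      (AsympAdd π φ ↔ ∃ ψ η : FinG G → V,
        (MemM π ψ ∧ IsAdditiveMap ψ) ∧ (MemM π η ∧ normG η = (0 : EReal)) ∧ φ = ψ + η)) ∧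
    -- … and the images of `M_⊕` and `A` in `M/N` coincide:
    (∀ φ : FinG G → V, MemM π φ → AsympAdd π φ →
      ∃ ψ : FinG G → V, MemM π ψ ∧ IsAdditiveMap ψ ∧ normG (φ - ψ) = (0 : EReal)) := by
  refine ⟨fun ψ hψ hc => ?_, fun φ hφ hc => ?_, fun φ hφ χ hχ hlim => ?_, fun φ hφ => ?_,
    fun φ hφ hA => ?_⟩
  · obtain ⟨χ, h1, h2, h3⟩ := hπ.exists_additive_limit hG ψ hψ fun ε hε => by
      obtain ⟨N, hN⟩ := hc ε hε
      exact ⟨N, fun m hm n hn => .of_normG_lt (hN m hm n hn)⟩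
    exact ⟨χ, h1, h2, (tendsto_normG_zero_iff hG).2 h3⟩
  · choose ψ hM hadd hψ using fun n => (hφ n).2.exists_additive hπ hG
    obtain ⟨χ, h1, h2, h3⟩ := hπ.exists_additive_limit hG ψ (fun n => ⟨hM n, hadd n⟩)
      fun ε hε => by
        obtain ⟨N, hN⟩ := hc (ε / 3) (by positivity)
        refine ⟨N, fun m hm n hn => ?_⟩
        simpa only [add_thirds] using
          ((hψ m (ε / 3) (by positivity)).sub_comm.sub_trans
            (.of_normG_lt (hN m hm n hn))).sub_trans (hψ n (ε / 3) (by positivity))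
    refine ⟨χ, h1, (asympAdd_iff hG).2 fun ε hε => ⟨χ, h1, h2, .of_forall fun F => ?_⟩,
      (tendsto_normG_zero_iff hG).2 fun ε hε => ?_⟩
    · simp only [sub_self, Pi.zero_apply, norm_zero]
      positivity
    · obtain ⟨N, hN⟩ := h3 (ε / 2) (half_pos hε)
      exact ⟨N, fun n hn => by
        simpa only [add_halves] using (hψ n (ε / 2) (half_pos hε)).sub_trans (hN n hn)⟩
  · refine (asympAdd_iff hG).2 fun ε hε => ?_
    obtain ⟨N, hN⟩ := (tendsto_normG_zero_iff hG).1 hlim (ε / 2) (half_pos hε)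
    obtain ⟨ψ, h1, h2, h3⟩ := (asympAdd_iff hG).1 (hφ N).2 (ε / 2) (half_pos hε)
    exact ⟨ψ, h1, h2, by simpa only [add_halves] using (hN N le_rfl).sub_comm.sub_trans h3⟩
  · constructor
    · intro hA
      obtain ⟨ψ, h1, h2, h3⟩ := hA.exists_additive hπ hG
      exact ⟨ψ, φ - ψ, ⟨h1, h2⟩, ⟨hφ.sub h1, (normG_eq_zero_iff hG).2 h3⟩, by simp⟩
    · rintro ⟨ψ, η, ⟨h1, h2⟩, ⟨-, h3⟩, rfl⟩
      refine (asympAdd_iff hG).2 fun ε hε => ⟨ψ, h1, h2, ?_⟩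
      rw [add_sub_cancel_left]
      exact (normG_eq_zero_iff hG).1 h3 ε hε
  · obtain ⟨ψ, h1, h2, h3⟩ := hA.exists_additive hπ hG
    exact ⟨ψ, h1, h2, (normG_eq_zero_iff hG).2 h3⟩
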